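/- arXiv:math-ph/0307051 — 4 statements merged into one kernel-verified Lean document; each statement's English description precedes it below -/
import Mathlib

section
/- Fix η > 0, set Δ = cosh η, fix r ∈ ℝ, and for x ∈ ℤ write εₓ = 2·cosh(η(x−r))²/(cosh(η(x−1−r))·cosh(η(x+1−r))). Define v₀ : ℤ → ℝ by v₀(x) = 1/cosh(η(x−r)). Then for every x ∈ ℤ: εₓ · v₀(x) − Δ⁻¹ · (v₀(x−1) + v₀(x+1)) = 0; that is, v₀ is a zero mode of the Jacobi matrix h̃^{(r)} with diagonal entries εₓ and off-diagonal entries −Δ⁻¹ on the two adjacent diagonals. -/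
/-- The sequence `v₀(x) = 1 / cosh (η (x - r))` is a zero mode of the Jacobi matrix
`h̃⁽ʳ⁾` with diagonal entries `εₓ = 2 cosh(η(x-r))² / (cosh(η(x-1-r)) cosh(η(x+1-r)))`
and off-diagonal entries `−Δ⁻¹`, where `Δ = cosh η`:
`εₓ v₀(x) − Δ⁻¹ (v₀(x−1) + v₀(x+1)) = 0`. -/
theorem zero_mode (η r : ℝ) (hη : 0 < η) (Δ : ℝ) (hΔ : Δ = Real.cosh η)
    (v₀ : ℤ → ℝ) (hv₀ : ∀ x : ℤ, v₀ x = 1 / Real.cosh (η * ((x : ℝ) - r))) :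
    ∀ x : ℤ,
      (2 * Real.cosh (η * ((x : ℝ) - r)) ^ 2 /
          (Real.cosh (η * ((x : ℝ) - 1 - r)) * Real.cosh (η * ((x : ℝ) + 1 - r)))) * v₀ x -
        Δ⁻¹ * (v₀ (x - 1) + v₀ (x + 1)) = 0 := by
  intro x
  have hsum : Real.cosh (η * ((x : ℝ) - 1 - r)) + Real.cosh (η * ((x : ℝ) + 1 - r)) =
      2 * Real.cosh (η * ((x : ℝ) - r)) * Real.cosh η := by
    rw [show η * ((x : ℝ) - 1 - r) = η * ((x : ℝ) - r) - η by ring,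
      show η * ((x : ℝ) + 1 - r) = η * ((x : ℝ) - r) + η by ring,
      Real.cosh_sub, Real.cosh_add]
    ring
  have h := (Real.cosh_pos (η * ((x : ℝ) - r))).ne'
  have hpred := (Real.cosh_pos (η * ((x : ℝ) - 1 - r))).ne'
  have hsucc := (Real.cosh_pos (η * ((x : ℝ) + 1 - r))).ne'
  have hη' := (Real.cosh_pos η).ne'
  simp only [hv₀, hΔ]
  push_cast
  rw [div_add_div _ _ hpred hsucc, one_mul, mul_one, add_comm (Real.cosh _), hsum]
  field_simp
  ring
end

section
/- Fix η > 0, set Δ = cosh η, fix r ∈ ℝ, and for x ∈ ℤ define γ_{x,x+1} = cosh(η(x−r))/(Δ·cosh(η(x+1−r))) + √(1−Δ⁻²)·tanh(η(x−r)). Then γ_{x,x+1} ≤ 1 for all x ∈ ℤ. -/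
/-- For `η ≥ 0`, the mixing amplitude `√(1 − (cosh η)⁻²)` equals `sinh η / cosh η`. -/
theorem sqrt_one_sub_inv_cosh_sq {η : ℝ} (hη : 0 ≤ η) :
    Real.sqrt (1 - ((Real.cosh η)⁻¹) ^ 2) = Real.sinh η / Real.cosh η := by
  have hc := Real.cosh_pos η
  have h : 1 - ((Real.cosh η)⁻¹) ^ 2 = (Real.sinh η / Real.cosh η) ^ 2 := by
    field_simp
    linarith [Real.cosh_sq η]
  rw [h, Real.sqrt_sq (div_nonneg (Real.sinh_nonneg_iff.2 hη) hc.le)]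

theorem cosh_div_cosh_mul_cosh_add_le_one (u v : ℝ) :
    Real.cosh u / (Real.cosh v * Real.cosh (u + v)) +
      Real.sinh v / Real.cosh v * Real.tanh u ≤ 1 := by
  have hv := Real.cosh_pos v
  have hu := Real.cosh_pos u
  have huv := Real.cosh_pos (u + v)
  have h : Real.cosh u ^ 2 + Real.sinh v * Real.sinh u * Real.cosh (u + v) ≤
      Real.cosh v * Real.cosh (u + v) * Real.cosh u := by
    have key : Real.cosh v * Real.cosh (u + v) * Real.cosh u -
        (Real.cosh u ^ 2 + Real.sinh v * Real.sinh u * Real.cosh (u + v)) =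
        Real.sinh v ^ 2 := by
      rw [Real.cosh_add]
      linear_combination Real.cosh u ^ 2 * Real.cosh_sq v + Real.sinh v ^ 2 * Real.cosh_sq u
    linarith [sq_nonneg (Real.sinh v)]
  have h_eq : Real.cosh u / (Real.cosh v * Real.cosh (u + v)) +
      Real.sinh v / Real.cosh v * Real.tanh u =
      (Real.cosh u ^ 2 + Real.sinh v * Real.sinh u * Real.cosh (u + v)) /
        (Real.cosh v * Real.cosh (u + v) * Real.cosh u) := by
    rw [Real.tanh_eq_sinh_div_cosh]
    field_simp
  rw [h_eq]
  exact div_le_one_of_le₀ h (by positivity)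


/-- The dynamical-interaction coefficient
`γ_{x,x+1} = cosh(η(x-r))/(Δ cosh(η(x+1-r))) + √(1−Δ⁻²) tanh(η(x-r))`,
with `Δ = cosh η`, satisfies `γ_{x,x+1} ≤ 1` for all `x ∈ ℤ`. -/
theorem gamma_le_one (η r : ℝ) (hη : 0 < η) (Δ : ℝ) (hΔ : Δ = Real.cosh η) :
    ∀ x : ℤ,
      Real.cosh (η * ((x : ℝ) - r)) / (Δ * Real.cosh (η * ((x : ℝ) + 1 - r))) +
          Real.sqrt (1 - (Δ⁻¹) ^ 2) * Real.tanh (η * ((x : ℝ) - r)) ≤ 1 := by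
  intro x
  rw [hΔ, sqrt_one_sub_inv_cosh_sq hη.le,
    show η * ((x : ℝ) + 1 - r) = η * ((x : ℝ) - r) + η by ring]
  exact cosh_div_cosh_mul_cosh_add_le_one _ _
end

section
/- Let ℓ > 0 and c ∈ [−1,1] be real numbers. Then the limit over natural numbers n of the complex numbers exp(−i·c·ℓ·√(n/2)) · (cos(ℓ/√(2n)) + i·c·sin(ℓ/√(2n)))ⁿ exists and equals exp(−ℓ²·(1−c²)/4). -/
open Filter

/-- The second-order Taylor quotient of `x ↦ exp (a x)` at `0`. -/
lemma tendsto_exp_mul_sub_div_sq (a : ℂ) :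
    Tendsto (fun x : ℝ => (Complex.exp (a * x) - 1 - a * x) / (x : ℂ) ^ 2)
      (nhdsWithin 0 {0}ᶜ) (nhds (a ^ 2 / 2)) := by
  have hlim : Tendsto (fun x : ℝ => a * (x : ℂ)) (nhds 0) (nhds 0) :=
    Continuous.tendsto' (by fun_prop) _ _ (by simp)
  have hexp := (Complex.exp_sub_sum_range_succ_isLittleO_pow 2).comp_tendsto hlim
  have hsq : ((fun z : ℂ => z ^ 2) ∘ fun x : ℝ => a * (x : ℂ)) =O[nhds 0]
      fun x : ℝ => (x : ℂ) ^ 2 := by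
    simpa [Function.comp_def, mul_pow] using
      Asymptotics.isBigO_const_mul_self (a ^ 2) (fun x : ℝ => (x : ℂ) ^ 2) (nhds 0)
  have hrem := ((hexp.trans_isBigO hsq).tendsto_div_nhds_zero.mono_left
    (nhdsWithin_le_nhds (s := {0}ᶜ))).add_const (a ^ 2 / 2)
  rw [zero_add] at hrem
  refine hrem.congr' ?_
  filter_upwards [self_mem_nhdsWithin] with x hx
  have hx : (x : ℂ) ≠ 0 := by simpa using hx
  simp only [Function.comp_apply, Finset.sum_range_succ, Finset.sum_range_zero, Nat.factorial]
  push_cast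
  field_simp
  ring

/-- The centred one-spin characteristic function is a two-point mixture of exponentials. -/
lemma exp_neg_mul_cos_add_sin (c x : ℂ) :
    Complex.exp (-(Complex.I * c * x)) * (Complex.cos x + Complex.I * c * Complex.sin x) =
      (1 + c) / 2 * Complex.exp (Complex.I * (1 - c) * x) +
        (1 - c) / 2 * Complex.exp (-(Complex.I * (1 + c)) * x) := by
  have hpos : Complex.exp (Complex.I * (1 - c) * x) =
      Complex.exp (-(Complex.I * c * x)) * Complex.exp (x * Complex.I) := by
    rw [← Complex.exp_add]; ring_nf
  have hneg : Complex.exp (-(Complex.I * (1 + c)) * x) =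
      Complex.exp (-(Complex.I * c * x)) * Complex.exp (-x * Complex.I) := by
    rw [← Complex.exp_add]; ring_nf
  rw [hpos, hneg, Complex.exp_mul_I, Complex.exp_mul_I, Complex.cos_neg, Complex.sin_neg]
  ring

/-- The centred one-spin characteristic function has variance `1 - c ^ 2`. -/
lemma tendsto_exp_neg_mul_cos_add_sin_sub_one_div_sq (c : ℂ) :
    Tendsto (fun x : ℝ => (Complex.exp (-(Complex.I * c * x)) *
        (Complex.cos x + Complex.I * c * Complex.sin x) - 1) / (x : ℂ) ^ 2)
      (nhdsWithin 0 {0}ᶜ) (nhds (-(1 - c ^ 2) / 2)) := by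
  have h := ((tendsto_exp_mul_sub_div_sq (Complex.I * (1 - c))).const_mul ((1 + c) / 2)).add
    ((tendsto_exp_mul_sub_div_sq (-(Complex.I * (1 + c)))).const_mul ((1 - c) / 2))
  convert h using 1
  · funext x
    rw [exp_neg_mul_cos_add_sin]
    ring
  · congr 1
    linear_combination (-(1 - c ^ 2) / 2) * Complex.I_sq

/-- Scalar one-site quantum central limit theorem for spin coherent states:
for `ℓ > 0` and `c ∈ [−1,1]`,
`exp(−i c ℓ √(n/2)) (cos(ℓ/√(2n)) + i c sin(ℓ/√(2n)))ⁿ → exp(−ℓ²(1−c²)/4)`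
as `n → ∞`. -/
theorem coherent_clt (ℓ c : ℝ) (hℓ : 0 < ℓ) (hc : c ∈ Set.Icc (-1 : ℝ) 1) :
    Tendsto
      (fun n : ℕ =>
        Complex.exp (-Complex.I * (c * ℓ * Real.sqrt ((n : ℝ) / 2) : ℝ)) *
          ((Real.cos (ℓ / Real.sqrt (2 * (n : ℝ))) : ℂ) +
            Complex.I * (c : ℂ) * (Real.sin (ℓ / Real.sqrt (2 * (n : ℝ))) : ℂ)) ^ n)
      atTop
      (nhds ((Real.exp (-(ℓ ^ 2 * (1 - c ^ 2) / 4)) : ℝ) : ℂ)) := by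
  set x : ℕ → ℝ := fun n => ℓ / Real.sqrt (2 * (n : ℝ)) with hxdef
  have hx_zero : Tendsto x atTop (nhds 0) :=
    tendsto_const_nhds.div_atTop (Real.tendsto_sqrt_atTop.comp
      (tendsto_natCast_atTop_atTop.const_mul_atTop two_pos))
  have hx_pos : ∀ᶠ n in atTop, 0 < x n := by
    filter_upwards [eventually_gt_atTop 0] with n hn
    have : (0 : ℝ) < n := by exact_mod_cast hn
    positivity
  have hx : Tendsto x atTop (nhdsWithin 0 {0}ᶜ) :=
    tendsto_nhdsWithin_iff.2 ⟨hx_zero, hx_pos.mono fun n hn => hn.ne'⟩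
  have hx_sq : ∀ᶠ n : ℕ in atTop, (n : ℝ) * x n ^ 2 = ℓ ^ 2 / 2 := by
    filter_upwards [eventually_gt_atTop 0] with n hn
    have : (0 : ℝ) < n := by exact_mod_cast hn
    rw [hxdef, div_pow, Real.sq_sqrt (by positivity)]
    field_simp
  have hx_sqrt : ∀ n : ℕ, ℓ * Real.sqrt ((n : ℝ) / 2) = n * x n := by
    intro n
    rcases n.eq_zero_or_pos with rfl | hn
    · simp
    have : (0 : ℝ) < n := by exact_mod_cast hn
    have hs : Real.sqrt ((n : ℝ) / 2) * Real.sqrt (2 * n) = n := by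
      rw [← Real.sqrt_mul (by positivity), show (n : ℝ) / 2 * (2 * n) = n ^ 2 by ring,
        Real.sqrt_sq this.le]
    have hs0 : Real.sqrt (2 * (n : ℝ)) ≠ 0 := by positivity
    rw [hxdef, mul_div_assoc', eq_div_iff hs0]
    linear_combination ℓ * hs
  have hlim : Tendsto (fun n : ℕ => (n : ℂ) * (Complex.exp (-(Complex.I * c * x n)) *
      (Complex.cos (x n) + Complex.I * c * Complex.sin (x n)) - 1)) atTop
      (nhds ((ℓ : ℂ) ^ 2 / 2 * (-(1 - (c : ℂ) ^ 2) / 2))) := by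
    refine (((tendsto_exp_neg_mul_cos_add_sin_sub_one_div_sq (c : ℂ)).comp hx).const_mul
      ((ℓ : ℂ) ^ 2 / 2)).congr' ?_
    filter_upwards [hx_sq, hx_pos] with n hsq hpos
    have hne : (x n : ℂ) ≠ 0 := by exact_mod_cast hpos.ne'
    have hsq' : (n : ℂ) * (x n : ℂ) ^ 2 = (ℓ : ℂ) ^ 2 / 2 := by exact_mod_cast hsq
    rw [← hsq', Function.comp_apply]
    field_simp
  convert! Complex.tendsto_one_add_pow_exp_of_tendsto hlim using 1
  · funext n
    rw [add_sub_cancel, mul_pow, ← Complex.exp_nat_mul, mul_assoc c, hx_sqrt]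
    push_cast
    congr 2
    · ring
    · simp [x]
  · push_cast
    congr 2
    ring
end

section
/- Fix η > 0, set Δ = cosh η, fix r ∈ ℝ, and for x ∈ ℤ write εₓ = 2·cosh(η(x−r))²/(cosh(η(x−1−r))·cosh(η(x+1−r))). Then for every finitely supported v : ℤ → ℂ, the quadratic form Σ_{x∈ℤ} conj(vₓ)·(εₓ·vₓ − Δ⁻¹·(v_{x−1} + v_{x+1})) is a nonnegative real number; that is, the Jacobi matrix h̃^{(r)} is a positive operator. -/
/-- Ground-state representation: a Jacobi form on `ℤ` with off-diagonal entries `-1` which annihilates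
the sequence `1 / c`, with `c` positive, is nonnegative. -/
theorem exists_nonneg_tsum_jacobi_form (c : ℤ → ℝ) (hc : ∀ x, 0 < c x)
    (v : ℤ → ℂ) (hv : (Function.support v).Finite) :
    ∃ t : ℝ, 0 ≤ t ∧
      ∑' x : ℤ, (starRingEnd ℂ) (v x) *
        ((c x / c (x - 1) + c x / c (x + 1) : ℝ) * v x - (v (x - 1) + v (x + 1))) = (t : ℂ) := by
  have hc0 : ∀ x, (c x : ℂ) ≠ 0 := fun x => by exact_mod_cast (hc x).ne'
  let E : ℤ → ℝ := fun x =>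
    Complex.normSq (c x * v x - c (x + 1) * v (x + 1)) / (c x * c (x + 1))
  let G : ℤ → ℂ := fun x =>
    (starRingEnd ℂ) (v (x + 1)) * ((c (x + 1) / c x : ℝ) * v (x + 1) - v x)
  have hshift : (Function.support fun x => v (x + 1)).Finite :=
    hv.preimage (add_left_injective (1 : ℤ)).injOn
  have hG : Summable G := by
    refine summable_of_hasFiniteSupport (hshift.subset fun x hx hvx => hx ?_)
    have hvx' : v (x + 1) = 0 := hvx
    simp [G, hvx']
  have hE : Summable fun x => (E x : ℂ) := by
    refine summable_of_hasFiniteSupport ((hv.union hshift).subset fun x hx => ?_)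
    by_contra hvx
    simp only [Set.mem_union, Function.mem_support, not_or, not_not] at hvx
    exact hx (by simp [E, hvx.1, hvx.2])
  have hG' : Summable fun x => G (x - 1) := (Equiv.subRight (1 : ℤ)).summable_iff.mpr hG
  have hGshift : ∑' x, G (x - 1) = ∑' x, G x := (Equiv.subRight (1 : ℤ)).tsum_eq G
  have hterm : ∀ x : ℤ, (starRingEnd ℂ) (v x) *
      ((c x / c (x - 1) + c x / c (x + 1) : ℝ) * v x - (v (x - 1) + v (x + 1))) =
      (E x : ℂ) + (G (x - 1) - G x) := by
    intro x
    have h₀ := hc0 x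
    have h₁ := hc0 (x + 1)
    have h₂ := hc0 (x - 1)
    simp only [E, G, sub_add_cancel]
    push_cast
    rw [← Complex.mul_conj]
    simp only [map_sub, map_mul, Complex.conj_ofReal]
    field_simp
    ring
  refine ⟨∑' x, E x, tsum_nonneg fun x =>
    div_nonneg (Complex.normSq_nonneg _) (mul_pos (hc x) (hc (x + 1))).le, ?_⟩
  rw [tsum_congr hterm, hE.tsum_add (hG'.sub hG), hG'.tsum_sub hG,
    hGshift, sub_self, add_zero, Complex.ofReal_tsum]

/-- Positivity of the Jacobi matrix `h̃⁽ʳ⁾`: for every finitely supported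
`v : ℤ → ℂ`, the quadratic form
`Σₓ conj(vₓ) (εₓ vₓ − Δ⁻¹(v_{x−1} + v_{x+1}))` is a nonnegative real number,
where `Δ = cosh η` and `εₓ = 2 cosh(η(x-r))² / (cosh(η(x-1-r)) cosh(η(x+1-r)))`. -/
theorem jacobi_positive (η r : ℝ) (hη : 0 < η) (Δ : ℝ) (hΔ : Δ = Real.cosh η)
    (v : ℤ → ℂ) (hv : (Function.support v).Finite) :
    ∃ t : ℝ, 0 ≤ t ∧
      (∑' x : ℤ,
        (starRingEnd ℂ) (v x) *
          ((2 * Real.cosh (η * ((x : ℝ) - r)) ^ 2 /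
              (Real.cosh (η * ((x : ℝ) - 1 - r)) * Real.cosh (η * ((x : ℝ) + 1 - r))) : ℝ) *
              v x -
            (Δ⁻¹ : ℝ) * (v (x - 1) + v (x + 1)))) = (t : ℂ) := by
  let c : ℤ → ℝ := fun x => Real.cosh (η * ((x : ℝ) - r))
  obtain ⟨t, ht, hsum⟩ :=
    exists_nonneg_tsum_jacobi_form c (fun x => Real.cosh_pos _) v hv
  have hΔ0 : 0 < Δ := hΔ ▸ Real.cosh_pos η
  refine ⟨Δ⁻¹ * t, mul_nonneg (inv_nonneg.mpr hΔ0.le) ht, ?_⟩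
  rw [Complex.ofReal_mul, ← hsum, ← tsum_mul_left]
  refine tsum_congr fun x => ?_
  have hε : 2 * Real.cosh (η * ((x : ℝ) - r)) ^ 2 /
      (Real.cosh (η * ((x : ℝ) - 1 - r)) * Real.cosh (η * ((x : ℝ) + 1 - r))) =
      Δ⁻¹ * (c x / c (x - 1) + c x / c (x + 1)) := by
    have hrec : Real.cosh (η * ((x : ℝ) - 1 - r)) + Real.cosh (η * ((x : ℝ) + 1 - r)) =
        2 * Δ * Real.cosh (η * ((x : ℝ) - r)) := by
      rw [show η * ((x : ℝ) - 1 - r) = η * ((x : ℝ) - r) - η by ring,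
        show η * ((x : ℝ) + 1 - r) = η * ((x : ℝ) - r) + η by ring,
        Real.cosh_sub, Real.cosh_add, hΔ]
      ring
    have h₁ := (Real.cosh_pos (η * ((x : ℝ) - 1 - r))).ne'
    have h₂ := (Real.cosh_pos (η * ((x : ℝ) + 1 - r))).ne'
    simp only [c]
    push_cast
    rw [div_add_div _ _ h₁ h₂, ← mul_div_assoc]
    congr 1
    field_simp
    linear_combination -hrec
  rw [hε]
  push_cast
  ring
end
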